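/- arXiv:1412.3688 — 4 statements merged into one kernel-verified Lean document; each statement's English description precedes it below -/
import Mathlib

section
/- Let P and S be strings over a finite alphabet Σ (0-indexed), and let i, j be indices with 1 ≤ i < |P| and 1 ≤ j < |S|. If P[i-1] = P[i], S[j-1] ≠ S[j], and the prefix P[0..i-1] of P of length i is a suffix of S[0..j-1], then S[j] ≠ P[i]; consequently the prefix P[0..i] of P of length i+1 is not a suffix of S[0..j]. (This is the paper's Lemma 1 for the nondeterministic KMP (prefix) automaton: any active state whose index is not the starting position of a run of P is dead when the next input position starts a new run of S.) -/
theorem List.getElem_eq_of_take_succ_suffix_take_succ {α : Type*} {P S : List α} {i j : ℕ}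
    (hi : i < P.length) (hj : j < S.length) (h : P.take (i + 1) <:+ S.take (j + 1)) :
    P[i] = S[j] := by
  obtain ⟨w, hw⟩ := h
  rw [List.take_succ_eq_append_getElem hi, List.take_succ_eq_append_getElem hj,
    ← List.append_assoc] at hw
  exact List.singleton_inj.mp (List.append_inj' hw rfl).2

theorem stmt_0 {α : Type*} [Fintype α] (P S : List α) (i j : ℕ)
    (hi1 : 1 ≤ i) (hi2 : i < P.length) (hj1 : 1 ≤ j) (hj2 : j < S.length)
    (hP : P[i - 1]'(by omega) = P[i]'hi2)
    (hS : S[j - 1]'(by omega) ≠ S[j]'hj2)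
    (hsuf : P.take i <:+ S.take j) :
    S[j]'hj2 ≠ P[i]'hi2 ∧ ¬ (P.take (i + 1) <:+ S.take (j + 1)) := by
  have hlast : P[i - 1]'(by omega) = S[j - 1]'(by omega) :=
    List.getElem_eq_of_take_succ_suffix_take_succ _ _
      (by rwa [Nat.sub_add_cancel hi1, Nat.sub_add_cancel hj1])
  have hne : S[j]'hj2 ≠ P[i]'hi2 := fun h => hS (hlast.symm.trans (hP.trans h.symm))
  exact ⟨hne, fun h => hne (List.getElem_eq_of_take_succ_suffix_take_succ hi2 hj2 h).symm⟩
end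

section
/- Let P be a string of length m whose run-length encoding rle(P) = ⟨(c_0,l_0),…,(c_{ρ-1},l_{ρ-1})⟩ has ρ ≥ 2 (i.e., P contains at least two distinct symbols), and let S be a string with run-length encoding of length at least i+1 for some i with 1 ≤ i ≤ |rle(S)| − 1. Then there exists at most one index j' in the interval [α_S(i), β_S(i)] such that j' ≥ m − 1 and S[j'−m+1..j'] = P (i.e., at most one occurrence of P in S ends at a position inside the i-th run of S); moreover, if such a j' exists then j' = α_S(i) + l_{ρ-1} − 1. -/
/-- Decoding of a run-length encoding: concatenation of the runs. -/
def decodeRLE {α : Type*} (r : List (α × ℕ)) : List α :=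
  r.foldr (fun p acc => List.replicate p.2 p.1 ++ acc) []

/-- `IsRLE r S` : `r` is the run-length encoding of `S`
    (all run lengths are ≥ 1, adjacent runs have distinct symbols, decoding gives `S`). -/
def IsRLE {α : Type*} (r : List (α × ℕ)) (S : List α) : Prop :=
  (∀ p ∈ r, 1 ≤ p.2) ∧ List.Chain' (fun p q => p.1 ≠ q.1) r ∧ decodeRLE r = S

/-- `rleStart r k` = α(k), the starting position of run `k` (sum of lengths of runs before `k`). -/
def rleStart {α : Type*} (r : List (α × ℕ)) (k : ℕ) : ℕ :=
  ((r.take k).map Prod.snd).sum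

theorem rleStart_succ {α : Type*} (r : List (α × ℕ)) (k : ℕ) (hk : k < r.length) :
    rleStart r (k + 1) = rleStart r k + r[k].2 := by
  rw [rleStart, List.take_succ_eq_append_getElem hk, List.map_append, List.sum_append]
  rfl

theorem length_decodeRLE {α : Type*} (r : List (α × ℕ)) :
    (decodeRLE r).length = rleStart r r.length := by
  induction r with
  | nil => simp [decodeRLE, rleStart]
  | cons p r ih => simpa [decodeRLE, rleStart] using ih

/-- Every position inside run `k` carries the symbol of run `k`. -/
theorem decodeRLE_getElem?_of_mem_run {α : Type*} (r : List (α × ℕ)) (k : ℕ) (hk : k < r.length)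
    (n : ℕ) (h1 : rleStart r k ≤ n) (h2 : n < rleStart r k + r[k].2) :
    (decodeRLE r)[n]? = some r[k].1 := by
  induction r generalizing k n with
  | nil => simp at hk
  | cons p r ih =>
    have hd : decodeRLE (p :: r) = List.replicate p.2 p.1 ++ decodeRLE r := rfl
    rw [hd]
    cases k with
    | zero =>
      simp only [rleStart, List.take_zero, List.map_nil, List.sum_nil, List.getElem_cons_zero,
        zero_add] at h2 ⊢
      rw [List.getElem?_append_left (by simpa using h2)]
      simp [h2]
    | succ k =>
      have hs : rleStart (p :: r) (k + 1) = p.2 + rleStart r k := by simp [rleStart]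
      rw [hs] at h1 h2
      simp only [List.getElem_cons_succ] at h2 ⊢
      rw [List.getElem?_append_right (by simp; omega), List.length_replicate]
      exact ih k (by simpa using hk) (n - p.2) (by omega) (by omega)

/-- Consecutive runs have distinct symbols. -/
theorem IsRLE.fst_ne_fst_succ {α : Type*} {r : List (α × ℕ)} {S : List α} (h : IsRLE r S) (k : ℕ)
    (hk : k + 1 < r.length) : r[k].1 ≠ r[k + 1].1 :=
  List.isChain_iff_getElem.mp h.2.1 k hk

theorem stmt_2 {α : Type*} [Fintype α] (P S : List α) (rP rS : List (α × ℕ))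
    (hP : IsRLE rP P) (hS : IsRLE rS S)
    (hρ : 2 ≤ rP.length)
    (i : ℕ) (hi1 : 1 ≤ i) (hi2 : i + 1 ≤ rS.length)
    (j' : ℕ)
    (h1 : rleStart rS i ≤ j')
    (h2 : j' ≤ rleStart rS i + (rS[i]'(by omega)).2 - 1)
    (h3 : P.length - 1 ≤ j')
    (h4 : (S.drop (j' + 1 - P.length)).take P.length = P) :
    j' = rleStart rS i + (rP[rP.length - 1]'(by omega)).2 - 1 := by
  obtain ⟨i, rfl⟩ := Nat.exists_eq_add_of_le' hi1
  obtain ⟨q, hq⟩ := Nat.exists_eq_add_of_le' hρ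
  have hi : i + 1 < rS.length := by omega
  have hq1 : q + 1 < rP.length := by omega
  have hlast : rP[rP.length - 1]'(by omega) = rP[q + 1] := by
    congr 1
    omega
  rw [hlast]
  have hneS := hS.fst_ne_fst_succ i hi
  have hneP := hP.fst_ne_fst_succ q hq1
  have hposS := hS.1 _ (List.getElem_mem (show i < rS.length by omega))
  have hposS' := hS.1 _ (List.getElem_mem hi)
  have hposP := hP.1 _ (List.getElem_mem (show q < rP.length by omega))
  have hposP' := hP.1 _ (List.getElem_mem hq1)
  have hstartS := rleStart_succ rS i (by omega)
  have hstartP := rleStart_succ rP q (by omega)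
  have hlen : P.length = rleStart rP (q + 1) + rP[q + 1].2 := by
    rw [← hP.2.2, length_decodeRLE, hq, rleStart_succ rP (q + 1) hq1]
  have hrunS := decodeRLE_getElem?_of_mem_run rS
  have hrunP := decodeRLE_getElem?_of_mem_run rP
  rw [hS.2.2] at hrunS
  rw [hP.2.2] at hrunP
  have hocc : ∀ k < P.length, S[j' + 1 - P.length + k]? = P[k]? := by
    intro k hk
    conv_rhs => rw [← h4]
    rw [List.getElem?_take_of_lt hk, List.getElem?_drop]
  have hend : rS[i + 1].1 = rP[q + 1].1 := by
    have h := hocc (P.length - 1) (by omega)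
    rw [hrunS (i + 1) hi _ (by omega) (by omega),
      hrunP (q + 1) hq1 _ (by omega) (by omega)] at h
    exact Option.some.inj h
  rcases lt_trichotomy (j' + 1) (rleStart rS (i + 1) + rP[q + 1].2) with hlt | heq | hgt
  · have h := hocc (rleStart rS (i + 1) - 1 - (j' + 1 - P.length)) (by omega)
    rw [hrunS i (by omega) _ (by omega) (by omega),
      hrunP (q + 1) hq1 _ (by omega) (by omega)] at h
    exact absurd ((Option.some.inj h).trans hend.symm) hneS
  · omega
  · have h := hocc (rleStart rP (q + 1) - 1) (by omega)
    rw [hrunS (i + 1) hi _ (by omega) (by omega),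
      hrunP q (by omega) _ (by omega) (by omega)] at h
    exact absurd ((Option.some.inj h).symm.trans hend) hneP
end

section
/- Let P be a string of length m containing at least two distinct symbols, and let S be a string with run-length encoding of length at least j+1 for some j ≥ 1. If some occurrence of P in S ends at a position inside the (j−1)-th run of S (i.e., there is t with α_S(j−1) ≤ t ≤ β_S(j−1), t ≥ m−1, and S[t−m+1..t] = P), then no occurrence of P in S ends at a position inside the j-th run of S. In other words, if P contains at least two distinct symbols, occurrences of P in S cannot end inside two consecutive runs of S. -/
theorem decodeRLE_getElem? {α : Type*} (r : List (α × ℕ)) (k t : ℕ) (hk : k < r.length)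
    (h1 : rleStart r k ≤ t) (h2 : t < rleStart r k + r[k].2) :
    (decodeRLE r)[t]? = some r[k].1 := by
  induction r generalizing k t with
  | nil => simp at hk
  | cons p r ih =>
    have hdec : decodeRLE (p :: r) = List.replicate p.2 p.1 ++ decodeRLE r := rfl
    rw [hdec]
    cases k with
    | zero =>
      have ht : t < p.2 := by simpa [rleStart] using h2
      rw [List.getElem?_append_left (by simpa using ht)]
      simp [ht]
    | succ k =>
      have hst : rleStart (p :: r) (k + 1) = p.2 + rleStart r k := by simp [rleStart]
      simp only [List.getElem_cons_succ] at h2 ⊢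
      rw [hst] at h1 h2
      rw [List.getElem?_append_right (by simp; omega), List.length_replicate]
      exact ih k (t - p.2) (by simpa using hk) (by omega) (by omega)

/-- The last symbol of an occurrence of `P` ending at position `t` of `S` is `S[t]`. -/
theorem getElem?_of_occurrence {α : Type*} {P S : List α} {t : ℕ} (hP : 0 < P.length)
    (ht : P.length - 1 ≤ t) (h : (S.drop (t + 1 - P.length)).take P.length = P) :
    S[t]? = P[P.length - 1]? := by
  have h' := congrArg (fun L : List α => L[P.length - 1]?) h
  simp only [List.getElem?_take, List.getElem?_drop] at h'
  rw [if_pos (by omega)] at h'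
  rw [← h']
  congr 1
  omega

theorem stmt_7 {α : Type*} [Fintype α] (P S : List α) (rS : List (α × ℕ))
    (hS : IsRLE rS S)
    (hdist : ∃ x ∈ P, ∃ y ∈ P, x ≠ y)
    (j : ℕ) (hj1 : 1 ≤ j) (hj2 : j + 1 ≤ rS.length)
    (hprev : ∃ t, rleStart rS (j - 1) ≤ t ∧
        t ≤ rleStart rS (j - 1) + (rS[j - 1]'(by omega)).2 - 1 ∧
        P.length - 1 ≤ t ∧ (S.drop (t + 1 - P.length)).take P.length = P) :
    ¬ ∃ t, rleStart rS j ≤ t ∧ t ≤ rleStart rS j + (rS[j]'(by omega)).2 - 1 ∧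
        P.length - 1 ≤ t ∧ (S.drop (t + 1 - P.length)).take P.length = P := by
  obtain ⟨hpos, hchain, rfl⟩ := hS
  obtain ⟨x, hx, -⟩ := hdist
  have hP : 0 < P.length := List.length_pos_of_mem hx
  obtain ⟨t, h1, h2, h3, h4⟩ := hprev
  rintro ⟨t', h1', h2', h3', h4'⟩
  obtain ⟨k, rfl⟩ : ∃ k, j = k + 1 := ⟨j - 1, by omega⟩
  simp only [Nat.add_sub_cancel] at h1 h2
  have hl := hpos _ (List.getElem_mem (l := rS) (n := k) (by omega))
  have hl' := hpos _ (List.getElem_mem (l := rS) (n := k + 1) (by omega))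
  have e := decodeRLE_getElem? rS k t (by omega) h1 (by omega)
  have e' := decodeRLE_getElem? rS (k + 1) t' (by omega) h1' (by omega)
  rw [getElem?_of_occurrence hP h3 h4] at e
  rw [getElem?_of_occurrence hP h3' h4', e] at e'
  exact List.isChain_iff_getElem.mp hchain k (by omega) (Option.some.inj e')
end

section
/- Let P be a string of length m over a finite alphabet Σ, and let S(P) be the nondeterministic finite automaton with ε-transitions whose state set is {I, q_0, q_1, …, q_m}, initial state I, accepting state q_m, with ε-transitions from I to every state, and transitions δ(q_i, c) = {q_{i+1}} if 0 ≤ i < m and c = P[i], and ∅ otherwise. Then for every nonempty string u over Σ and every 0 ≤ i ≤ m, the state q_i is reachable from I by reading u if and only if |u| ≤ i and P[i−|u| .. i−1] = u (i.e., u is the substring of P of length |u| ending at position i−1). -/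
/-- Configurations of an NFA: set of states reachable from the set `I` by reading the string,
    iterating the transition function over the symbols. -/
def nfaDeltaStar {σ β : Type*} (δ : σ → β → Set σ) : Set σ → List β → Set σ
  | I, [] => I
  | I, c :: u => nfaDeltaStar δ (⋃ q ∈ I, δ q c) u


/-- Transition function of the nondeterministic suffix automaton `S(P)` (symbol transitions):
    states are `I` (= `none`) and `q_i` (= `some i`) for `0 ≤ i ≤ |P|`;
    `δ(q_i, c) = {q_{i+1}}` iff `i < |P|` and `c = P[i]`, and `∅` otherwise. -/
def suffDelta {α : Type*} (P : List α) (q : Option ℕ) (c : α) : Set (Option ℕ) :=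
  {q' | ∃ i, q = some i ∧ q' = some (i + 1) ∧ P[i]? = some c}

/-- The ε-closure of the initial state `I`: all the states of `S(P)`. -/
def suffInit (m : ℕ) : Set (Option ℕ) :=
  {none} ∪ {q | ∃ i ≤ m, q = some i}

/-- State `q_i` is reached from `S` by reading `u` iff `u` occurs in `P` at some position `j` with
`q_j ∈ S`, and this occurrence ends right before position `i`. -/
theorem some_mem_nfaDeltaStar_suffDelta_iff {α : Type*} (P u : List α) (S : Set (Option ℕ))
    (i : ℕ) :
    some i ∈ nfaDeltaStar (suffDelta P) S u ↔
      ∃ j, some j ∈ S ∧ i = j + u.length ∧ u <+: P.drop j := by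
  induction u generalizing S with
  | nil => simp [nfaDeltaStar]
  | cons c u ih =>
    have step (j : ℕ) : c :: u <+: P.drop j ↔ P[j]? = some c ∧ u <+: P.drop (j + 1) := by
      rw [← List.tail_drop, ← List.head?_drop]
      cases P.drop j <;> simp [List.cons_prefix_cons, eq_comm]
    rw [nfaDeltaStar, ih]
    simp only [Set.mem_iUnion, suffDelta, Set.mem_ofPred_eq, List.length_cons, step]
    constructor
    · rintro ⟨_, ⟨_, hS, j, rfl, hj, hc⟩, rfl, hu⟩
      obtain rfl := Option.some.inj hj
      exact ⟨j, hS, by omega, hc, hu⟩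
    · rintro ⟨j, hS, rfl, hc, hu⟩
      exact ⟨j + 1, ⟨some j, hS, j, rfl, rfl, hc⟩, by omega, hu⟩

theorem stmt_16 {α : Type*} [Fintype α] (P u : List α) (hu : u ≠ []) (i : ℕ)
    (hi : i ≤ P.length) :
    some i ∈ nfaDeltaStar (suffDelta P) (suffInit P.length) u ↔
      (u.length ≤ i ∧ (P.drop (i - u.length)).take u.length = u) := by
  rw [some_mem_nfaDeltaStar_suffDelta_iff]
  simp only [List.prefix_iff_eq_take]
  constructor
  · rintro ⟨j, -, rfl, h⟩
    exact ⟨by omega, by rw [Nat.add_sub_cancel]; exact h.symm⟩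
  · rintro ⟨hle, h⟩
    exact ⟨i - u.length, Or.inr ⟨_, by omega, rfl⟩, by omega, h.symm⟩
end
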